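/- Suppose the lower endpoint x̲ of the support of the noise density f is finite and the hazard rate x ↦ f(x)/(1−F(x)) is nonincreasing on {x ∈ [x̲, x̄) : F(x) < 1} (the decreasing failure rate, DFR, case). Then g(x̲; v^EPS) = f(x̲)/n, and for every t ∈ ℝ and every prize schedule v ∈ 𝒱, g(t; v) ≤ f(x̲)/n. (Equal prize sharing with the threshold at the lower endpoint of the support maximizes the marginal benefit of effort over all thresholds and all prize schedules.) -/

import Mathlib

open MeasureTheory

/-- The CDF associated with a density `f`. -/
noncomputable def Fcdf (f : ℝ → ℝ) (x : ℝ) : ℝ := ∫ u in Set.Iic x, f u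

/-- `F_{(j:m)}`, the CDF of the `j`-th smallest of `m` i.i.d. draws (binomial-sum form),
with the convention `F_{(0:m)} ≡ 1`. -/
noncomputable def Fos (f : ℝ → ℝ) (j m : ℕ) (x : ℝ) : ℝ :=
  if j = 0 then 1
  else ∑ k ∈ Finset.Icc j m, (m.choose k : ℝ) * Fcdf f x ^ k * (1 - Fcdf f x) ^ (m - k)

/-- `f_{(j:m)}`, the density of the `j`-th smallest of `m` i.i.d. draws,
with the convention `f_{(0:m)} ≡ 0`. -/
noncomputable def fos (f : ℝ → ℝ) (j m : ℕ) (x : ℝ) : ℝ :=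
  if j = 0 then 0
  else (j : ℝ) * (m.choose j : ℝ) * Fcdf f x ^ (j - 1) * (1 - Fcdf f x) ^ (m - j) * f x

/-- The marginal-benefit coefficient `B_r(t)`. -/
noncomputable def Bcoef (f : ℝ → ℝ) (n r : ℕ) (t : ℝ) : ℝ :=
  f t * Fos f (n - r) (n - 1) t + ∫ x in Set.Ioi t, f x * fos f (n - r) (n - 1) x

/-- The marginal benefit of effort `g(t; v)` with threshold `t` and prize schedule `v`. -/
noncomputable def gmb (f : ℝ → ℝ) (n : ℕ) (v : ℕ → ℝ) (t : ℝ) : ℝ :=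
  ∑ r ∈ Finset.Icc 1 n, Bcoef f n r t * (v r - v (r + 1))

/-- A noise density: nonnegative, bounded, integrating to one, vanishing outside
`[xl, xu]` and continuous there.  The endpoints may be infinite. -/
def IsNoiseDensity (f : ℝ → ℝ) (xl xu : EReal) : Prop :=
  xl < xu ∧ (∀ x, 0 ≤ f x) ∧ (∃ M, ∀ x, f x ≤ M) ∧ (∫ x, f x = 1) ∧
    (∀ x : ℝ, ((x : EReal) < xl ∨ xu < (x : EReal)) → f x = 0) ∧
    ContinuousOn f {x : ℝ | xl ≤ (x : EReal) ∧ (x : EReal) ≤ xu}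

/-- A prize schedule `v = (v 1, …, v n)`: nonincreasing, nonnegative, summing to one,
with the convention `v (n+1) = 0`. -/
def IsPrizeSchedule (n : ℕ) (v : ℕ → ℝ) : Prop :=
  (∀ r ∈ Finset.Icc 1 n, 0 ≤ v r) ∧ (∀ r, 1 ≤ r → r < n → v (r + 1) ≤ v r) ∧
    (∑ r ∈ Finset.Icc 1 n, v r = 1) ∧ v (n + 1) = 0

/-- `m` is a mode of `f`. -/
def IsMode (f : ℝ → ℝ) (m : ℝ) : Prop :=
  ∃ a b : ℝ, a < m ∧ m < b ∧ MonotoneOn f (Set.Icc a m) ∧ AntitoneOn f (Set.Icc m b) ∧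
    f a < f m ∧ f b < f m

/-- `f` is piecewise monotone: away from finitely many points it is monotone. -/
def PiecewiseMonotone (f : ℝ → ℝ) : Prop :=
  ∃ s : Finset ℝ, ∀ a b : ℝ, a < b → (∀ c ∈ s, c ∉ Set.Ioo a b) →
    MonotoneOn f (Set.Ioo a b) ∨ AntitoneOn f (Set.Ioo a b)

/-- The probability that at least `j` of `m` independent trials succeed, each with
probability `u`. -/
noncomputable def binomTail (j m : ℕ) (u : ℝ) : ℝ :=
  ∑ k ∈ Finset.Icc j m, (m.choose k : ℝ) * u ^ k * (1 - u) ^ (m - k)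

theorem hasDerivAt_binomTail_add (d : ℕ) : ∀ (j : ℕ) (u : ℝ), 1 ≤ j →
    HasDerivAt (binomTail j (j + d))
      (j * ((j + d).choose j : ℝ) * u ^ (j - 1) * (1 - u) ^ d) u := by
  induction d with
  | zero =>
    intro j u _
    have h : binomTail j (j + 0) = fun u => u ^ j := by
      funext u
      simp [binomTail]
    rw [h]
    simpa using hasDerivAt_pow j u
  | succ d ih =>
    intro j u hj
    have hsplit : binomTail j (j + (d + 1)) = fun u =>
        ((j + (d + 1)).choose j : ℝ) * (u ^ j * (1 - u) ^ (d + 1))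
          + binomTail (j + 1) (j + 1 + d) u := by
      funext u
      have hm : j + 1 + d = j + (d + 1) := by ring
      rw [hm, binomTail, binomTail, ← Finset.add_sum_Ioc_eq_sum_Icc (by omega),
        ← Order.succ_eq_add_one j, Finset.Icc_succ_left_eq_Ioc]
      simp only [Nat.add_sub_cancel_left]
      ring
    have hpow : HasDerivAt (fun u : ℝ => (1 - u) ^ (d + 1))
        (((d + 1 : ℕ) : ℝ) * (1 - u) ^ d * (-1)) u := by
      simpa using ((hasDerivAt_id u).const_sub 1).fun_pow (d + 1)
    have hterm := (((hasDerivAt_pow j u).mul hpow).const_mul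
      ((j + (d + 1)).choose j : ℝ)).add (ih (j + 1) u (by omega))
    rw [hsplit]
    refine hterm.congr_deriv ?_
    have hm : j + 1 + d = j + (d + 1) := by ring
    have hc : ((j + (d + 1)).choose (j + 1) : ℝ) * (j + 1)
        = ((j + (d + 1)).choose j : ℝ) * (d + 1) := by
      have := Nat.choose_succ_right_eq (j + (d + 1)) j
      rw [Nat.add_sub_cancel_left] at this
      exact_mod_cast this
    rw [hm, Nat.add_sub_cancel]
    push_cast
    linear_combination u ^ j * (1 - u) ^ d * hc

theorem hasDerivAt_binomTail {j m : ℕ} (hj : 1 ≤ j) (hjm : j ≤ m) (u : ℝ) :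
    HasDerivAt (binomTail j m) (j * (m.choose j : ℝ) * u ^ (j - 1) * (1 - u) ^ (m - j)) u := by
  obtain ⟨d, rfl⟩ := Nat.exists_eq_add_of_le hjm
  simpa using hasDerivAt_binomTail_add d j u hj

theorem binomTail_one {j m : ℕ} (hjm : j ≤ m) : binomTail j m 1 = 1 := by
  rw [binomTail, Finset.sum_eq_single_of_mem m (Finset.mem_Icc.2 ⟨hjm, le_rfl⟩)]
  · simp
  · intro k hk hkm
    have : m - k ≠ 0 := by
      have := (Finset.mem_Icc.1 hk).2
      omega
    simp [this]

/-- The identity `m.choose k * (m + 1) = (m + 1).choose k * (m + 1 - k)` over the reals. -/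
theorem cast_choose_mul_succ {k m : ℕ} (hk : k ≤ m + 1) :
    (m.choose k : ℝ) * (m + 1) = ((m + 1).choose k : ℝ) * (m + 1 - k) := by
  have := Nat.choose_mul_succ_eq m k
  have h : ((m + 1 - k : ℕ) : ℝ) = m + 1 - k := by push_cast [Nat.cast_sub hk]; ring
  rw [← h]
  exact_mod_cast this

theorem one_sub_mul_binomTail_le (j m : ℕ) {u : ℝ} (hu0 : 0 ≤ u) (hu1 : u ≤ 1) :
    (m + 1) * ((1 - u) * binomTail j m u) ≤ (m + 1 - j) * binomTail j (m + 1) u := by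
  have h1u : 0 ≤ 1 - u := sub_nonneg.2 hu1
  calc (m + 1) * ((1 - u) * binomTail j m u)
      = ∑ k ∈ Finset.Icc j m,
          (m + 1 - k : ℝ) * (((m + 1).choose k : ℝ) * u ^ k * (1 - u) ^ (m + 1 - k)) := by
        rw [binomTail, Finset.mul_sum, Finset.mul_sum]
        refine Finset.sum_congr rfl fun k hk => ?_
        have hkm := (Finset.mem_Icc.1 hk).2
        rw [Nat.succ_sub hkm, pow_succ]
        linear_combination (1 - u) * u ^ k * (1 - u) ^ (m - k) *
          cast_choose_mul_succ (show k ≤ m + 1 by omega)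
    _ ≤ ∑ k ∈ Finset.Icc j (m + 1),
          (m + 1 - k : ℝ) * (((m + 1).choose k : ℝ) * u ^ k * (1 - u) ^ (m + 1 - k)) := by
        refine Finset.sum_le_sum_of_subset_of_nonneg
          (Finset.Icc_subset_Icc_right (by omega)) fun k hk _ => ?_
        have : (k : ℝ) ≤ m + 1 := by exact_mod_cast (Finset.mem_Icc.1 hk).2
        have : 0 ≤ (m + 1 - k : ℝ) := by linarith
        positivity
    _ ≤ (m + 1 - j) * binomTail j (m + 1) u := by
        rw [binomTail, Finset.mul_sum]
        refine Finset.sum_le_sum fun k hk => ?_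
        have : (j : ℝ) ≤ k := by exact_mod_cast (Finset.mem_Icc.1 hk).1
        gcongr

theorem sum_mul_sub_succ (v : ℕ → ℝ) (n : ℕ) :
    ∑ r ∈ Finset.Icc 1 n, (r : ℝ) * (v r - v (r + 1))
      = ∑ r ∈ Finset.Icc 1 n, v r - n * v (n + 1) := by
  induction n with
  | zero => simp
  | succ n ih =>
    rw [Finset.sum_Icc_succ_top (by omega), Finset.sum_Icc_succ_top (by omega), ih]
    push_cast
    ring

section Density

variable {f : ℝ → ℝ}

theorem Fcdf_sub_Fcdf (hi : Integrable f) (x y : ℝ) :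
    Fcdf f y - Fcdf f x = ∫ u in x..y, f u :=
  intervalIntegral.integral_Iic_sub_Iic hi.integrableOn hi.integrableOn

theorem continuous_Fcdf (hi : Integrable f) : Continuous (Fcdf f) := by
  have h : Fcdf f = fun y => Fcdf f 0 + ∫ u in (0 : ℝ)..y, f u := by
    funext y
    rw [← Fcdf_sub_Fcdf hi]
    ring
  rw [h]
  exact continuous_const.add
    (intervalIntegral.continuous_primitive (fun _ _ => hi.intervalIntegrable) 0)

theorem hasDerivAt_Fcdf (hi : Integrable f) {x : ℝ} (hx : ContinuousAt f x) :
    HasDerivAt (Fcdf f) (f x) x := by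
  have h : Fcdf f = fun y => Fcdf f 0 + ∫ u in (0 : ℝ)..y, f u := by
    funext y
    rw [← Fcdf_sub_Fcdf hi]
    ring
  rw [h]
  exact (intervalIntegral.integral_hasDerivAt_right hi.intervalIntegrable
    hi.aestronglyMeasurable.stronglyMeasurableAtFilter hx).const_add _

theorem Fcdf_nonneg (h0 : ∀ x, 0 ≤ f x) (x : ℝ) : 0 ≤ Fcdf f x :=
  integral_nonneg h0

theorem Fcdf_le_one (hi : Integrable f) (h0 : ∀ x, 0 ≤ f x) (h1 : ∫ x, f x = 1) (x : ℝ) :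
    Fcdf f x ≤ 1 :=
  h1 ▸ setIntegral_le_integral hi (ae_of_all _ h0)

theorem tendsto_Fcdf_atTop (hi : Integrable f) (h1 : ∫ x, f x = 1) :
    Filter.Tendsto (Fcdf f) Filter.atTop (nhds 1) :=
  h1 ▸ (aecover_Iic Filter.tendsto_id).integral_tendsto_of_countably_generated hi

theorem Fcdf_eq_zero {a : ℝ} (h : ∀ x < a, f x = 0) : Fcdf f a = 0 := by
  rw [Fcdf, integral_Iic_eq_integral_Iio]
  exact setIntegral_eq_zero_of_forall_eq_zero h

theorem Fcdf_eq_one (h1 : ∫ x, f x = 1) {b : ℝ} (h : ∀ x, b < x → f x = 0) : Fcdf f b = 1 := by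
  rw [← h1]
  exact setIntegral_eq_integral_of_forall_compl_eq_zero fun x hx => h x (not_le.1 hx)

/-- A density vanishes where its CDF has already reached one, if it is right-continuous there. -/
theorem eq_zero_of_Fcdf_eq_one (hi : Integrable f) (h0 : ∀ x, 0 ≤ f x) (h1 : ∫ x, f x = 1)
    {x : ℝ} (hc : ContinuousWithinAt f (Set.Ioi x) x) (hx : Fcdf f x = 1) : f x = 0 := by
  by_contra hne
  have hpos : 0 < f x := lt_of_le_of_ne (h0 x) (Ne.symm hne)
  have hev : ∀ᶠ y in nhdsWithin x (Set.Ioi x), 0 < f y := hc.eventually (lt_mem_nhds hpos)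
  obtain ⟨z, hxz, hz⟩ := (mem_nhdsGT_iff_exists_Ioo_subset).1 hev
  have hint := intervalIntegral.intervalIntegral_pos_of_pos_on
    (hi.intervalIntegrable (a := x) (b := z)) (fun y hy => hz hy) hxz
  rw [← Fcdf_sub_Fcdf hi] at hint
  linarith [Fcdf_le_one hi h0 h1 z]

theorem Bcoef_self (n : ℕ) (t : ℝ) : Bcoef f n n t = f t := by
  simp [Bcoef, Fos, fos]

theorem Bcoef_of_lt {n r : ℕ} (hr : r < n) (t : ℝ) :
    Bcoef f n r t = f t * binomTail (n - r) (n - 1) (Fcdf f t) +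
      ∫ x in Set.Ioi t, f x * (((n - r : ℕ) : ℝ) * ((n - 1).choose (n - r) : ℝ) *
        Fcdf f x ^ (n - r - 1) * (1 - Fcdf f x) ^ (n - 1 - (n - r)) * f x) := by
  have h : n - r ≠ 0 := by omega
  simp only [Bcoef, Fos, fos, if_neg h, binomTail]

theorem binomTail_nonneg (j m : ℕ) {u : ℝ} (hu0 : 0 ≤ u) (hu1 : u ≤ 1) :
    0 ≤ binomTail j m u := by
  have : 0 ≤ 1 - u := sub_nonneg.2 hu1
  unfold binomTail
  positivity

/-- If `f ≤ c (1 - F)` and `f` is continuous to the right of `t`, then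
`B_r(t)` is at most `c r / n`. -/
theorem Bcoef_le (hi : Integrable f) (h0 : ∀ x, 0 ≤ f x) (h1 : ∫ x, f x = 1) {c : ℝ}
    (hfc : ∀ x, f x ≤ c * (1 - Fcdf f x)) {t : ℝ} (hcont : ∀ x, t < x → ContinuousAt f x)
    {n r : ℕ} (hr1 : 1 ≤ r) (hr : r < n) : Bcoef f n r t ≤ c * (r / n) := by
  obtain ⟨m, rfl⟩ : ∃ m, n = m + 1 := ⟨n - 1, by omega⟩
  obtain ⟨j, hj⟩ : ∃ j, j = m + 1 - r := ⟨_, rfl⟩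
  have hj1 : 1 ≤ j := by omega
  have hjm : j ≤ m := by omega
  have hrj : (r : ℝ) = m + 1 - j := by
    rw [eq_sub_iff_add_eq]
    exact_mod_cast (by omega : r + j = m + 1)
  have hF0 := Fcdf_nonneg h0
  have hF1 := Fcdf_le_one hi h0 h1
  have hc : 0 ≤ c := by
    obtain ⟨x, hx⟩ : ∃ x, 0 < f x := by
      by_contra! h
      have : f = 0 := funext fun x => le_antisymm (h x) (h0 x)
      simp [this] at h1
    by_contra! hneg
    nlinarith [hfc x, hF1 x]
  rw [Bcoef_of_lt hr, ← hj, Nat.add_sub_cancel]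
  set p : ℝ → ℝ := fun x => (j : ℝ) * (m.choose j : ℝ) *
    Fcdf f x ^ (j - 1) * (1 - Fcdf f x) ^ (m - j) * f x with hp
  have hp0 : ∀ x, 0 ≤ p x := fun x => by
    have := h0 x
    have := hF0 x
    have : 0 ≤ 1 - Fcdf f x := sub_nonneg.2 (hF1 x)
    simp only [hp]
    positivity
  set q : ℝ → ℝ := fun x => c * (r / (m + 1)) * binomTail j (m + 1) (Fcdf f x) with hq
  have hqcont : Continuous q := by
    have := continuous_Fcdf hi
    simp only [hq, binomTail]
    fun_prop
  have hqderiv : ∀ x ∈ Set.Ioi t, HasDerivAt q (c * (1 - Fcdf f x) * p x) x := fun x hx => by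
    refine (((hasDerivAt_binomTail hj1 (show j ≤ m + 1 by omega) (Fcdf f x)).comp x
      (hasDerivAt_Fcdf hi (hcont x hx))).const_mul (c * (r / (m + 1)))).congr_deriv ?_
    have hchoose := cast_choose_mul_succ (show j ≤ m + 1 by omega)
    rw [← hrj] at hchoose
    simp only [hp, Nat.succ_sub hjm, pow_succ]
    field_simp
    linear_combination -(c * Fcdf f x ^ (j - 1) * f x * (1 - Fcdf f x) ^ (m - j) *
      (1 - Fcdf f x)) * hchoose
  have hqlim : Filter.Tendsto q Filter.atTop (nhds (c * (r / (m + 1)))) := by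
    have hb : Continuous (binomTail j (m + 1)) := by
      unfold binomTail
      fun_prop
    have := ((hb.tendsto 1).comp (tendsto_Fcdf_atTop hi h1)).const_mul (c * (r / (m + 1)))
    rwa [binomTail_one (by omega), mul_one] at this
  have hqnonneg : ∀ x ∈ Set.Ioi t, 0 ≤ c * (1 - Fcdf f x) * p x := fun x _ =>
    mul_nonneg (mul_nonneg hc (sub_nonneg.2 (hF1 x))) (hp0 x)
  have hint : ∫ x in Set.Ioi t, f x * p x
      ≤ c * (r / (m + 1)) - c * (r / (m + 1)) * binomTail j (m + 1) (Fcdf f t) := by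
    rw [show c * (r / (m + 1)) * binomTail j (m + 1) (Fcdf f t) = q t from rfl, ← integral_Ioi_of_hasDerivAt_of_nonneg
      hqcont.continuousWithinAt hqderiv hqnonneg hqlim]
    exact integral_mono_of_nonneg (ae_of_all _ fun x => mul_nonneg (h0 x) (hp0 x))
      (integrableOn_Ioi_deriv_of_nonneg hqcont.continuousWithinAt hqderiv hqnonneg hqlim)
      (ae_of_all _ fun x => mul_le_mul_of_nonneg_right (hfc x) (hp0 x))
  have hhead : f t * binomTail j m (Fcdf f t)
      ≤ c * (r / (m + 1)) * binomTail j (m + 1) (Fcdf f t) := by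
    calc f t * binomTail j m (Fcdf f t)
        ≤ c * (1 - Fcdf f t) * binomTail j m (Fcdf f t) :=
          mul_le_mul_of_nonneg_right (hfc t) (binomTail_nonneg _ _ (hF0 t) (hF1 t))
      _ = c * ((1 - Fcdf f t) * binomTail j m (Fcdf f t)) := by ring
      _ ≤ c * ((r / (m + 1)) * binomTail j (m + 1) (Fcdf f t)) := by
          refine mul_le_mul_of_nonneg_left ?_ hc
          have := one_sub_mul_binomTail_le j m (hF0 t) (hF1 t)
          rw [← hrj] at this
          rw [div_mul_eq_mul_div, le_div_iff₀ (by positivity)]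
          linarith
      _ = _ := by ring
  push_cast
  linarith

/-- Below the support, raising the threshold to its lower endpoint does not decrease `B_r`. -/
theorem Bcoef_le_of_le {a t : ℝ} (h0 : ∀ x, 0 ≤ f x) (hi : Integrable f)
    (h1 : ∫ x, f x = 1) (ha : ∀ x < a, f x = 0) (hta : t < a) {n r : ℕ} (hr : r < n) :
    Bcoef f n r t ≤ Bcoef f n r a := by
  rw [Bcoef_of_lt hr, Bcoef_of_lt hr, ha t hta, zero_mul, zero_add,
    ← integral_Ici_eq_integral_Ioi (x := a),
    setIntegral_eq_of_subset_of_forall_sdiff_eq_zero measurableSet_Ioi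
      (Set.Ici_subset_Ioi.2 hta) fun x hx => by simp [ha x (not_le.1 hx.2)]]
  exact le_add_of_nonneg_left
    (mul_nonneg (h0 a) (binomTail_nonneg _ _ (Fcdf_nonneg h0 a) (Fcdf_le_one hi h0 h1 a)))

/-- Under a decreasing failure rate, the hazard rate is bounded by its value at the lower
endpoint of the support. -/
theorem le_mul_one_sub_Fcdf {xl : ℝ} {xu : EReal} (hi : Integrable f)
    (hf : IsNoiseDensity f (xl : EReal) xu)
    (hdfr : ∀ x y : ℝ, xl ≤ x → x ≤ y → (x : EReal) < xu → (y : EReal) < xu →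
      Fcdf f x < 1 → Fcdf f y < 1 →
      f y / (1 - Fcdf f y) ≤ f x / (1 - Fcdf f x)) (x : ℝ) :
    f x ≤ f xl * (1 - Fcdf f x) := by
  obtain ⟨hlu, h0, -, h1, hvan, hcont⟩ := hf
  have hF1 := Fcdf_le_one hi h0 h1
  have hFl : Fcdf f xl = 0 := Fcdf_eq_zero fun y hy => hvan y (Or.inl (by exact_mod_cast hy))
  have hnn : ∀ y, 0 ≤ f xl * (1 - Fcdf f y) := fun y =>
    mul_nonneg (h0 xl) (sub_nonneg.2 (hF1 y))
  have hlt : ∀ y : ℝ, (y : EReal) < xu → f y ≤ f xl * (1 - Fcdf f y) := by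
    intro y hyu
    rcases lt_or_ge y xl with hyl | hyl
    · rw [hvan y (Or.inl (by exact_mod_cast hyl))]
      exact hnn y
    rcases (hF1 y).lt_or_eq with hFy | hFy
    · have := hdfr xl y le_rfl hyl hlu hyu (by simp [hFl]) hFy
      rw [hFl, sub_zero, div_one, div_le_iff₀ (sub_pos.2 hFy)] at this
      exact this
    · rw [eq_zero_of_Fcdf_eq_one hi h0 h1 ?_ hFy]
      · exact hnn y
      refine (hcont y ⟨by exact_mod_cast hyl, hyu.le⟩).mono_of_mem_nhdsWithin ?_
      have hopen : ∀ᶠ z : ℝ in nhds y, (z : EReal) < xu :=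
        continuous_coe_real_ereal.continuousAt.eventually (gt_mem_nhds hyu)
      filter_upwards [hopen.filter_mono nhdsWithin_le_nhds, self_mem_nhdsWithin] with z hz hyz
      exact ⟨by exact_mod_cast hyl.trans (le_of_lt hyz), hz.le⟩
  rcases lt_trichotomy (x : EReal) xu with hx | rfl | hx
  · exact hlt x hx
  · have hlx : xl < x := by exact_mod_cast hlu
    have hleft : Filter.Tendsto f (nhdsWithin x (Set.Ioo xl x)) (nhds (f x)) :=
      (hcont x ⟨hlu.le, le_rfl⟩).mono fun y hy =>
        ⟨by exact_mod_cast hy.1.le, by exact_mod_cast hy.2.le⟩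
    have : (nhdsWithin x (Set.Ioo xl x)).NeBot := by
      rw [nhdsWithin_Ioo_eq_nhdsLT hlx]
      infer_instance
    refine le_of_tendsto_of_tendsto hleft
      (((continuous_const.mul (continuous_const.sub (continuous_Fcdf hi))).tendsto x).mono_left
        nhdsWithin_le_nhds) ?_
    filter_upwards [self_mem_nhdsWithin] with y hy
    exact hlt y (by exact_mod_cast hy.2)
  · rw [hvan x (Or.inr hx)]
    exact hnn x

theorem continuousAt_of_le_mul_one_sub_Fcdf {xl : ℝ} {xu : EReal}
    (hf : IsNoiseDensity f (xl : EReal) xu) {c : ℝ} (hfc : ∀ x, f x ≤ c * (1 - Fcdf f x))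
    {x : ℝ} (hx : xl < x) : ContinuousAt f x := by
  obtain ⟨hlu, h0, -, h1, hvan, hcont⟩ := hf
  suffices h : ContinuousOn f (Set.Ici xl) from h.continuousAt (Ici_mem_nhds hx)
  induction xu with
  | bot => simp at hlu
  | top => exact hcont.mono fun y hy => ⟨by exact_mod_cast hy, le_top⟩
  | coe b =>
    have hlb : xl < b := by exact_mod_cast hlu
    have hvanb : ∀ y, b < y → f y = 0 := fun y hy => hvan y (Or.inr (by exact_mod_cast hy))
    have hb : f b = 0 := by
      have := hfc b
      rw [Fcdf_eq_one h1 hvanb, sub_self, mul_zero] at this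
      exact le_antisymm this (h0 b)
    have hright : ContinuousOn f (Set.Ici b) :=
      (continuousOn_const (c := (0 : ℝ))).congr fun y hy => by
        rcases (Set.mem_Ici.1 hy).eq_or_lt with rfl | hy
        exacts [hb, hvanb y hy]
    have hleft : ContinuousOn f (Set.Icc xl b) :=
      hcont.mono fun y hy => ⟨by exact_mod_cast hy.1, by exact_mod_cast hy.2⟩
    rw [← Set.Icc_union_Ici_eq_Ici hlb.le]
    exact hleft.union_of_isClosed hright isClosed_Icc isClosed_Ici

end Density

/-- In the DFR case (hazard rate nonincreasing on `{x ∈ [x̲, x̄) : F x < 1}`,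
with `x̲` finite), equal prize sharing with the threshold at the lower endpoint of the
support maximizes the marginal benefit of effort over all thresholds and prize schedules:
`g(x̲; v^EPS) = f(x̲)/n` and `g(t; v) ≤ f(x̲)/n`. -/
theorem stmt8 (n : ℕ) (hn : 2 ≤ n) (f : ℝ → ℝ) (xl : ℝ) (xu : EReal)
    (hf : IsNoiseDensity f (xl : EReal) xu)
    (hdfr : ∀ x y : ℝ, xl ≤ x → x ≤ y → (x : EReal) < xu → (y : EReal) < xu →
      Fcdf f x < 1 → Fcdf f y < 1 →
      f y / (1 - Fcdf f y) ≤ f x / (1 - Fcdf f x)) :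
    gmb f n (fun r => if r ≤ n then (1 : ℝ) / (n : ℝ) else 0) xl = f xl / (n : ℝ) ∧
      ∀ t : ℝ, ∀ v : ℕ → ℝ, IsPrizeSchedule n v → gmb f n v t ≤ f xl / (n : ℝ) := by
  have hn0 : (0 : ℝ) < n := by exact_mod_cast (by omega : 0 < n)
  have hi : Integrable f := by
    by_contra h
    exact zero_ne_one ((integral_undef h).symm.trans hf.2.2.2.1)
  have hfc := le_mul_one_sub_Fcdf hi hf hdfr
  have hcont := fun x (hx : xl < x) => continuousAt_of_le_mul_one_sub_Fcdf hf hfc hx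
  obtain ⟨-, h0, -, h1, hvan, -⟩ := hf
  have hbelow : ∀ x < xl, f x = 0 := fun x hx => hvan x (Or.inl (by exact_mod_cast hx))
  have hB : ∀ t : ℝ, ∀ r ∈ Finset.Icc 1 n, Bcoef f n r t ≤ f xl * (r / n) := by
    intro t r hr
    obtain ⟨hr1, hrn⟩ := Finset.mem_Icc.1 hr
    rcases hrn.eq_or_lt with rfl | hrn
    · rw [Bcoef_self, div_self hn0.ne', mul_one]
      exact (hfc t).trans (mul_le_of_le_one_right (h0 xl) (by linarith [Fcdf_nonneg h0 t]))
    rcases lt_or_ge t xl with ht | ht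
    · exact (Bcoef_le_of_le h0 hi h1 hbelow ht hrn).trans (Bcoef_le hi h0 h1 hfc hcont hr1 hrn)
    · exact Bcoef_le hi h0 h1 hfc (fun x hx => hcont x (ht.trans_lt hx)) hr1 hrn
  constructor
  · rw [gmb, Finset.sum_eq_single_of_mem n (Finset.mem_Icc.2 ⟨by omega, le_rfl⟩)]
    · simp [Bcoef_self, div_eq_mul_inv]
    · intro r hr hrn
      have := (Finset.mem_Icc.1 hr).2
      simp [this, show r + 1 ≤ n by omega]
  · rintro t v ⟨hv0, hvanti, hvsum, hvn⟩
    calc gmb f n v t ≤ ∑ r ∈ Finset.Icc 1 n, f xl * (r / n) * (v r - v (r + 1)) := by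
          refine Finset.sum_le_sum fun r hr => mul_le_mul_of_nonneg_right (hB t r hr) ?_
          obtain ⟨hr1, hrn⟩ := Finset.mem_Icc.1 hr
          rcases hrn.eq_or_lt with rfl | hrn
          · rw [hvn, sub_zero]
            exact hv0 r hr
          · exact sub_nonneg.2 (hvanti r hr1 hrn)
      _ = f xl / n * ∑ r ∈ Finset.Icc 1 n, (r : ℝ) * (v r - v (r + 1)) := by
          rw [Finset.mul_sum]
          exact Finset.sum_congr rfl fun r _ => by ring
      _ = f xl / n := by rw [sum_mul_sub_succ, hvsum, hvn]; ring
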